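/- Let α ∈ {1,−1}, let c ∈ ℂ, let u, v : ℝ → ℝ, and set Q(x) = Q(u(x), v(x)). Suppose J : ℝ → M₃(ℂ) is differentiable and satisfies J′(x) − i α c [Λ, J(x)] = Q(x) J(x) for all x ∈ ℝ. Then the matrix function K(x) := Σ (conj(J(x)))ᵀ Σ⁻¹ (entrywise complex conjugation followed by transpose) satisfies K′(x) − i α c̄ [Λ, K(x)] = −K(x) Q(x) for all x ∈ ℝ. -/

import Mathlib

open Matrix

/-- `Λ = diag(−1, 1, 1)`. -/
noncomputable def Lam : Matrix (Fin 3) (Fin 3) ℂ :=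
  Matrix.diagonal ![(-1 : ℂ), 1, 1]

/-- The potential matrix `Q(u,v)` of the coupled mKdV Lax pair. -/
noncomputable def Qmat (α u v : ℝ) : Matrix (Fin 3) (Fin 3) ℂ :=
  !![0, (α : ℂ) * (u : ℂ), (α : ℂ) * (v : ℂ);
     (u : ℂ), 0, 0;
     (v : ℂ), 0, 0]

/-- The symmetry matrix `Σ = diag(−1, 1/α, 1/α)`. -/
noncomputable def Sig (α : ℝ) : Matrix (Fin 3) (Fin 3) ℂ :=
  Matrix.diagonal ![(-1 : ℂ), 1 / (α : ℂ), 1 / (α : ℂ)]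

/-- `K(x) = Σ (conj J(x))ᵀ Σ⁻¹`; note `(conj J)ᵀ = Jᴴ`. -/
noncomputable def Kfun (α : ℝ) (J : ℝ → Matrix (Fin 3) (Fin 3) ℂ) (x : ℝ) :
    Matrix (Fin 3) (Fin 3) ℂ :=
  Sig α * (J x)ᴴ * (Sig α)⁻¹

theorem Sig_inv {α : ℝ} (hα : α ≠ 0) :
    (Sig α)⁻¹ = Matrix.diagonal ![(-1 : ℂ), (α : ℂ), (α : ℂ)] := by
  have hα' : (α : ℂ) ≠ 0 := Complex.ofReal_ne_zero.mpr hα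
  refine Matrix.inv_eq_right_inv ?_
  rw [Sig, Matrix.diagonal_mul_diagonal, ← Matrix.diagonal_one]
  congr 1
  ext i
  fin_cases i <;> simp [hα']

theorem Lam_conjTranspose : Lamᴴ = Lam := by
  rw [Lam, Matrix.diagonal_conjTranspose]
  congr 1
  ext i
  fin_cases i <;> simp

theorem Sig_mul_Lam (α : ℝ) : Sig α * Lam = Lam * Sig α := by
  simp only [Sig, Lam, Matrix.diagonal_mul_diagonal, mul_comm]

theorem Sig_inv_mul_Lam {α : ℝ} (hα : α ≠ 0) : (Sig α)⁻¹ * Lam = Lam * (Sig α)⁻¹ := by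
  simp only [Sig_inv hα, Lam, Matrix.diagonal_mul_diagonal, mul_comm]

theorem Qmat_conjTranspose_mul_Sig_inv {α : ℝ} (hα : α ≠ 0) (u v : ℝ) :
    (Qmat α u v)ᴴ * (Sig α)⁻¹ = -((Sig α)⁻¹ * Qmat α u v) := by
  rw [Sig_inv hα]
  ext i j
  fin_cases i <;> fin_cases j <;>
    simp [Qmat, Matrix.mul_diagonal, Matrix.diagonal_mul, mul_comm]

/-- The equation for `J` turns into the equation for `K` under `M ↦ Σ Mᴴ Σ⁻¹`. -/
theorem Sig_mul_conjTranspose_mul_Sig_inv {α : ℝ} (hα : α ≠ 0) (c : ℂ) (u v : ℝ)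
    (M : Matrix (Fin 3) (Fin 3) ℂ) :
    Sig α * ((Complex.I * (α : ℂ) * c) • (Lam * M - M * Lam) + Qmat α u v * M)ᴴ * (Sig α)⁻¹ =
      (Complex.I * (α : ℂ) * (starRingEnd ℂ c)) •
          (Lam * (Sig α * Mᴴ * (Sig α)⁻¹) - Sig α * Mᴴ * (Sig α)⁻¹ * Lam)
        - Sig α * Mᴴ * (Sig α)⁻¹ * Qmat α u v := by
  have hstar : star (Complex.I * (α : ℂ) * c) = -(Complex.I * (α : ℂ) * starRingEnd ℂ c) := by
    simp [mul_comm]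
  have hleft : Lam * (Sig α * Mᴴ * (Sig α)⁻¹) = Sig α * (Lam * Mᴴ) * (Sig α)⁻¹ := by
    simp only [← mul_assoc, Sig_mul_Lam]
  have hright : Sig α * Mᴴ * (Sig α)⁻¹ * Lam = Sig α * (Mᴴ * Lam) * (Sig α)⁻¹ := by
    simp only [mul_assoc, Sig_inv_mul_Lam hα]
  have hQ : Sig α * (Mᴴ * (Qmat α u v)ᴴ) * (Sig α)⁻¹ =
      -(Sig α * Mᴴ * (Sig α)⁻¹ * Qmat α u v) := by
    simp only [mul_assoc, Qmat_conjTranspose_mul_Sig_inv hα, mul_neg]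
  rw [Matrix.conjTranspose_add, Matrix.conjTranspose_smul, Matrix.conjTranspose_sub,
    Matrix.conjTranspose_mul, Matrix.conjTranspose_mul, Matrix.conjTranspose_mul,
    Lam_conjTranspose, hstar, mul_add, add_mul, hQ, hleft, hright, mul_smul_comm,
    smul_mul_assoc, mul_sub, sub_mul, neg_smul, ← smul_neg, neg_sub, ← sub_eq_add_neg]

/-- Entrywise differentiability passes through `M ↦ A Mᴴ B`. -/
theorem hasDerivAt_mul_conjTranspose_mul {n : Type*} [Fintype n] (A B : Matrix n n ℂ)
    {J : ℝ → Matrix n n ℂ} {J' : Matrix n n ℂ} {x : ℝ}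
    (hJ : ∀ i j, HasDerivAt (fun y => J y i j) (J' i j) x) (i j : n) :
    HasDerivAt (fun y => (A * (J y)ᴴ * B) i j) ((A * J'ᴴ * B) i j) x := by
  simp only [Matrix.mul_apply, Matrix.conjTranspose_apply]
  exact HasDerivAt.fun_sum fun k _ =>
    (HasDerivAt.fun_sum fun l _ => (hJ k l).star.const_mul (A i l)).mul_const (B k j)

/-- if `J` is differentiable (entrywise) with
`J′(x) − iαc [Λ, J(x)] = Q(x) J(x)` for all `x`, then
`K(x) = Σ (conj J(x))ᵀ Σ⁻¹` satisfies `K′(x) − i α c̄ [Λ, K(x)] = −K(x) Q(x)`. -/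
theorem stmt1 (α : ℝ) (hα : α = 1 ∨ α = -1) (c : ℂ) (u v : ℝ → ℝ)
    (J : ℝ → Matrix (Fin 3) (Fin 3) ℂ)
    (hJ : ∀ (x : ℝ) (i j : Fin 3), HasDerivAt (fun y => J y i j)
      (((Complex.I * (α : ℂ) * c) • (Lam * J x - J x * Lam)
        + Qmat α (u x) (v x) * J x) i j) x) :
    ∀ (x : ℝ) (i j : Fin 3), HasDerivAt (fun y => Kfun α J y i j)
      (((Complex.I * (α : ℂ) * (starRingEnd ℂ c)) •
          (Lam * Kfun α J x - Kfun α J x * Lam)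
        - Kfun α J x * Qmat α (u x) (v x)) i j) x := by
  have hα0 : α ≠ 0 := by rcases hα with rfl | rfl <;> norm_num
  intro x i j
  have h := hasDerivAt_mul_conjTranspose_mul (Sig α) (Sig α)⁻¹ (hJ x) i j
  rwa [Sig_mul_conjTranspose_mul_Sig_inv hα0] at h
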